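/- For all integers a, b ≥ 0, the Durfee-square identity holds in ℤ[q]: ∑_{k=0}^{min(a,b)} [a, k]_q · [b, k]_q · q^{k²} = [a+b, a]_q. -/

import Mathlib

/-- The Gaussian (q-)binomial coefficient `[n, k]_q` as a polynomial in `ℤ[q]`,
defined by `[n, 0] = 1`, `[0, k+1] = 0` and
`[n+1, k+1] = [n, k] + q^(k+1) * [n, k+1]` (so `[n, k] = 0` for `k > n`). -/
noncomputable def gaussBinom : ℕ → ℕ → Polynomial ℤ
  | _, 0 => 1
  | 0, _ + 1 => 0
  | n + 1, k + 1 => gaussBinom n k + Polynomial.X ^ (k + 1) * gaussBinom n (k + 1)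

theorem gaussBinom_zero_right (n : ℕ) : gaussBinom n 0 = 1 := by
  cases n <;> rfl

theorem gaussBinom_succ_succ (n k : ℕ) :
    gaussBinom (n + 1) (k + 1) =
      gaussBinom n k + Polynomial.X ^ (k + 1) * gaussBinom n (k + 1) := rfl

theorem gaussBinom_eq_zero_of_lt {n k : ℕ} (h : n < k) : gaussBinom n k = 0 := by
  induction n generalizing k with
  | zero =>
    obtain ⟨k, rfl⟩ := Nat.exists_eq_succ_of_ne_zero h.ne'
    rfl
  | succ n ih =>
    obtain ⟨k, rfl⟩ := Nat.exists_eq_succ_of_ne_zero (Nat.ne_zero_of_lt h)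
    rw [Nat.succ_eq_add_one, gaussBinom_succ_succ, ih (by lia), ih (by lia), mul_zero, add_zero]

/-- The second Pascal recurrence `[n+1, k+1] = [n, k+1] + q^(n-k) [n, k]`. -/
theorem gaussBinom_succ_succ' {n k : ℕ} (h : k ≤ n) :
    gaussBinom (n + 1) (k + 1) =
      gaussBinom n (k + 1) + Polynomial.X ^ (n - k) * gaussBinom n k := by
  induction n generalizing k with
  | zero =>
    obtain rfl : k = 0 := by lia
    simp [gaussBinom]
  | succ n ih =>
    cases k with
    | zero =>
      have h₀ := ih (Nat.zero_le n)
      rw [gaussBinom_succ_succ (n + 1) 0]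
      conv_rhs => rw [gaussBinom_succ_succ n 0]
      rw [h₀]
      simp only [gaussBinom_zero_right, Nat.sub_zero]
      ring
    | succ k =>
      have h₁ := ih (k := k) (by lia)
      rw [gaussBinom_succ_succ (n + 1) (k + 1), Nat.add_sub_add_right]
      rcases (show k ≤ n by lia).eq_or_lt with rfl | hk
      · rw [gaussBinom_eq_zero_of_lt (show k + 1 < k + 1 + 1 by lia)]
        simp
      · have h₂ := ih (k := k + 1) (by lia)
        have hpow : (Polynomial.X : Polynomial ℤ) ^ (n - k) =
            Polynomial.X ^ (n - (k + 1)) * Polynomial.X := by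
          rw [← pow_succ]
          congr 1
          lia
        have h₃ := gaussBinom_succ_succ n k
        have h₄ := gaussBinom_succ_succ n (k + 1)
        rw [hpow] at h₁ ⊢
        linear_combination Polynomial.X ^ (k + 2) * h₂ + h₁ - h₄ -
          Polynomial.X ^ (n - (k + 1)) * Polynomial.X * h₃

/-- A form of the `q`-Vandermonde identity. -/
theorem sum_gaussBinom_mul_gaussBinom (a b c : ℕ) :
    ∑ k ∈ Finset.range (b + 1),
      gaussBinom a (k + c) * gaussBinom b k * Polynomial.X ^ (k * (k + c))
    = gaussBinom (a + b) (b + c) := by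
  induction b generalizing c with
  | zero => simp [gaussBinom_zero_right]
  | succ b ih =>
    have hstep : ∀ k ∈ Finset.range (b + 1),
        gaussBinom a (k + 1 + c) * gaussBinom (b + 1) (k + 1) *
            Polynomial.X ^ ((k + 1) * (k + 1 + c)) =
          gaussBinom a (k + 1 + c) * gaussBinom b (k + 1) *
            Polynomial.X ^ ((k + 1) * (k + 1 + c)) +
          Polynomial.X ^ (b + c + 1) * (gaussBinom a (k + (c + 1)) * gaussBinom b k *
            Polynomial.X ^ (k * (k + (c + 1)))) := by
      intro k hk
      have hkb : k ≤ b := by simpa [Nat.lt_succ_iff] using hk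
      obtain ⟨m, rfl⟩ := Nat.exists_eq_add_of_le hkb
      rw [gaussBinom_succ_succ' hkb, Nat.add_sub_cancel_left, show k + (c + 1) = k + 1 + c by ring]
      ring
    have hlow := Finset.sum_range_succ' (fun k =>
      gaussBinom a (k + c) * gaussBinom b k * Polynomial.X ^ (k * (k + c))) (b + 1)
    rw [Finset.sum_range_succ, ih c, gaussBinom_eq_zero_of_lt (Nat.lt_succ_self b)] at hlow
    rw [Finset.sum_range_succ', Finset.sum_congr rfl hstep, Finset.sum_add_distrib,
      ← Finset.mul_sum, ih (c + 1), ← add_assoc a b 1, show b + 1 + c = b + c + 1 by ring,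
      gaussBinom_succ_succ, ← add_assoc b c 1]
    simp only [gaussBinom_zero_right] at hlow ⊢
    linear_combination -hlow

/-- the Durfee-square identity
`∑_{k=0}^{min(a,b)} [a,k]_q [b,k]_q q^{k²} = [a+b, a]_q` in `ℤ[q]`. -/
theorem stmt9 (a b : ℕ) :
    ∑ k ∈ Finset.range (min a b + 1),
      gaussBinom a k * gaussBinom b k * Polynomial.X ^ (k ^ 2)
    = gaussBinom (a + b) a := by
  have h := sum_gaussBinom_mul_gaussBinom b a 0
  simp only [add_zero] at h
  rw [add_comm a b, ← h]
  simp only [sq, mul_comm (gaussBinom a _)]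
  refine Finset.sum_subset (Finset.range_mono (by lia)) fun k hk hk' => ?_
  simp only [Finset.mem_range] at hk hk'
  rw [gaussBinom_eq_zero_of_lt (show b < k by lia), zero_mul, zero_mul]
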